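/- Let D ⊂ ℝ^N be a bounded open set, ρ : ℝ^N → [0,∞) Borel measurable and locally bounded, and Ψ : ℝ → ℝ a nondecreasing Borel function. Let u, v : ℝ^N → ℝ be bounded continuous functions such that ρ·Ψ(u) and ρ·Ψ(v) are locally integrable on D and, in the distributional sense on D, Δ^{α/2}u ≤ ρ·Ψ(u) and Δ^{α/2}v ≥ ρ·Ψ(v). If u ≥ v on ℝ^N ∖ D, then u ≥ v on all of ℝ^N. -/

import Mathlib

open MeasureTheory Real Filter Topology

noncomputable section

/-- The constant `c_{N,-α} = 2^α · π^{-N/2} · Γ((N+α)/2) / |Γ(-α/2)|`. -/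
def fracLapCoeff (N : ℕ) (α : ℝ) : ℝ :=
  2 ^ α * Real.pi ^ (-(N : ℝ) / 2) * Real.Gamma (((N : ℝ) + α) / 2) / |Real.Gamma (-α / 2)|

/-- The fractional Laplacian `Δ^{α/2}θ` of a test function `θ`. -/
def fracLap (N : ℕ) (α : ℝ) (θ : EuclideanSpace ℝ (Fin N) → ℝ)
    (x : EuclideanSpace ℝ (Fin N)) : ℝ :=
  (fracLapCoeff N α / 2) *
    ∫ z : EuclideanSpace ℝ (Fin N), (θ (x + z) + θ (x - z) - 2 * θ x) / ‖z‖ ^ ((N : ℝ) + α)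

section IntegralSecondDifference

variable {E : Type*} [NormedAddCommGroup E] [MeasurableSpace E] [BorelSpace E]
  (μ : Measure E) [μ.IsAddHaarMeasure]

theorem integrable_second_difference {θ : E → ℝ} (hθ : Continuous θ)
    (hc : HasCompactSupport θ) (z : E) :
    Integrable (fun x => θ (x + z) + θ (x - z) - 2 * θ x) μ := by
  have h := hθ.integrable_of_hasCompactSupport (μ := μ) hc
  exact ((h.comp_add_right z).add (h.comp_sub_right z)).sub (h.const_mul 2)

theorem integral_mul_second_difference {θ : E → ℝ} (hθ : Continuous θ)
    (hc : HasCompactSupport θ) {w : E → ℝ} (hw : Continuous w) (z : E) (s : ℝ) :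
    ∫ x, w x * ((θ (x + z) + θ (x - z) - 2 * θ x) / s) ∂μ =
      ((∫ x, w x * θ (x + z) ∂μ) + (∫ x, w x * θ (x - z) ∂μ) - 2 * ∫ x, w x * θ x ∂μ) / s := by
  have hi (a : E) : Integrable (fun x => w x * θ (x + a)) μ :=
    (hw.mul (by fun_prop)).integrable_of_hasCompactSupport
      ((hc.comp_homeomorph (Homeomorph.addRight a)).mul_left)
  have h1 := hi z
  have h2 : Integrable (fun x => w x * θ (x - z)) μ := by simpa [sub_eq_add_neg] using hi (-z)
  have h0 : Integrable (fun x => w x * θ x) μ := by simpa using hi 0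
  rw [← integral_const_mul, ← integral_add h1 h2,
    ← integral_sub (f := fun x => w x * θ (x + z) + w x * θ (x - z)) (h1.add h2) (h0.const_mul 2),
    ← integral_div]
  refine integral_congr_ae (ae_of_all _ fun x => ?_)
  ring

end IntegralSecondDifference

section SecondDifference

variable {E : Type*} [NormedAddCommGroup E] [NormedSpace ℝ E]

theorem exists_abs_second_difference_le {θ : E → ℝ} (hθ : ContDiff ℝ 2 θ)
    (hc : HasCompactSupport θ) :
    ∃ C : ℝ, 0 ≤ C ∧ ∀ x z, |θ (x + z) + θ (x - z) - 2 * θ x| ≤ C * ‖z‖ ^ 2 := by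
  obtain ⟨K, hK⟩ := (hθ.fderiv_right (m := 1) (by norm_num)).lipschitzWith_of_hasCompactSupport
    (hc.fderiv ℝ) one_ne_zero
  have hd : Differentiable ℝ θ := hθ.differentiable (by norm_num)
  refine ⟨K, K.2, fun x z => ?_⟩
  have hder (s : E) : HasFDerivAt (fun s => θ (s + z) - θ s)
      (fderiv ℝ θ (s + z) - fderiv ℝ θ s) s :=
    ((hasFDerivAt_comp_add_right z).2 (hd (s + z)).hasFDerivAt).sub (hd s).hasFDerivAt
  have key := convex_univ.norm_image_sub_le_of_norm_hasFDerivWithin_le (𝕜 := ℝ)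
    (f := fun s => θ (s + z) - θ s) (C := K * ‖z‖) (x := x - z) (y := x)
    (fun s _ => (hder s).hasFDerivWithinAt)
    (fun s _ => by simpa using hK.norm_sub_le (s + z) s) trivial trivial
  simp only [sub_add_cancel, sub_sub_cancel, Real.norm_eq_abs] at key
  calc |θ (x + z) + θ (x - z) - 2 * θ x|
      = |θ (x + z) - θ x - (θ x - θ (x - z))| := by congr 1; ring
    _ ≤ K * ‖z‖ * ‖z‖ := key
    _ = K * ‖z‖ ^ 2 := by ring

variable [FiniteDimensional ℝ E] [MeasurableSpace E] [BorelSpace E]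
  (μ : Measure E) [μ.IsAddHaarMeasure]

theorem exists_integral_abs_second_difference_le {θ : E → ℝ} (hθ : ContDiff ℝ 2 θ)
    (hc : HasCompactSupport θ) :
    ∃ C : ℝ, 0 ≤ C ∧
      ∀ z, ∫ x, |θ (x + z) + θ (x - z) - 2 * θ x| ∂μ ≤ C * min (‖z‖ ^ 2) 1 := by
  obtain ⟨K, hK0, hK⟩ := exists_abs_second_difference_le hθ hc
  obtain ⟨R, hR⟩ := hc.isCompact.isBounded.subset_closedBall 0
  have hvan {y : E} (hy : R < ‖y‖) : θ y = 0 := by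
    by_contra h
    exact absurd (mem_closedBall_zero_iff.1 (hR (subset_tsupport θ h))) (not_le.2 hy)
  have hθi := hθ.continuous.integrable_of_hasCompactSupport (μ := μ) hc
  set B := Metric.closedBall (0 : E) (R + 1)
  have hB : MeasurableSet B := Metric.isClosed_closedBall.measurableSet
  have hBf : μ B ≠ ⊤ := measure_closedBall_lt_top.ne
  set I := ∫ x, |θ x| ∂μ
  have hI : 0 ≤ I := integral_nonneg fun _ => abs_nonneg _
  have hKB : 0 ≤ K * μ.real B := mul_nonneg hK0 measureReal_nonneg
  refine ⟨K * μ.real B + 4 * I, by positivity, fun z => ?_⟩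
  rcases le_or_gt ‖z‖ 1 with hz | hz
  · rw [min_eq_left (by nlinarith [norm_nonneg z])]
    calc ∫ x, |θ (x + z) + θ (x - z) - 2 * θ x| ∂μ
        ≤ ∫ x, B.indicator (fun _ => K * ‖z‖ ^ 2) x ∂μ := by
          refine integral_mono (integrable_second_difference μ hθ.continuous hc z).abs
            ((integrable_indicator_iff hB).2 (integrableOn_const hBf)) fun x => ?_
          by_cases hx : x ∈ B
          · simpa [hx] using hK x z
          · have hx' : R + 1 < ‖x‖ := by simpa [B] using hx
            have h1 := norm_sub_le_norm_add x z
            have h2 := norm_sub_norm_le x z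
            simp [hx, hvan (y := x) (by linarith), hvan (y := x + z) (by linarith),
              hvan (y := x - z) (by linarith)]
      _ = K * μ.real B * ‖z‖ ^ 2 := by
          rw [integral_indicator hB, setIntegral_const, smul_eq_mul]; ring
      _ ≤ (K * μ.real B + 4 * I) * ‖z‖ ^ 2 := by gcongr; linarith
  · rw [min_eq_right (by nlinarith), mul_one]
    calc ∫ x, |θ (x + z) + θ (x - z) - 2 * θ x| ∂μ
        ≤ ∫ x, (|θ (x + z)| + |θ (x - z)| + 2 * |θ x|) ∂μ := by
          refine integral_mono (integrable_second_difference μ hθ.continuous hc z).abs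
            (((hθi.abs.comp_add_right z).add (hθi.abs.comp_sub_right z)).add
              (hθi.abs.const_mul 2)) fun x => ?_
          refine (abs_sub _ _).trans (add_le_add (abs_add_le _ _) ?_)
          rw [abs_mul, abs_two]
      _ = 4 * I := by
          rw [integral_add (f := fun x => |θ (x + z)| + |θ (x - z)|)
            ((hθi.abs.comp_add_right z).add (hθi.abs.comp_sub_right z))
            (hθi.abs.const_mul 2), integral_add (hθi.abs.comp_add_right z)
            (hθi.abs.comp_sub_right z), integral_const_mul,
            integral_add_right_eq_self (fun x => |θ x|) z,
            integral_sub_right_eq_self (fun x => |θ x|) z]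
          ring
      _ ≤ K * μ.real B + 4 * I := by linarith

theorem integrable_min_sq_one_div_rpow [Nontrivial E] {α : ℝ} (hα1 : 0 < α) (hα2 : α < 2) :
    Integrable (fun z : E => min (‖z‖ ^ 2) 1 / ‖z‖ ^ ((Module.finrank ℝ E : ℝ) + α)) μ := by
  rw [integrable_fun_norm_addHaar μ
    (f := fun r : ℝ => min (r ^ 2) 1 / r ^ ((Module.finrank ℝ E : ℝ) + α))]
  have hd : 0 < Module.finrank ℝ E := Module.finrank_pos
  have hpow {r : ℝ} (hr : 0 < r) : r ^ (Module.finrank ℝ E - 1) /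
      r ^ ((Module.finrank ℝ E : ℝ) + α) = r ^ (-1 - α) := by
    rw [← Real.rpow_natCast, ← Real.rpow_sub hr, Nat.cast_sub hd]
    congr 1; push_cast; ring
  rw [← Set.Ioc_union_Ioi_eq_Ioi zero_le_one, integrableOn_union]
  constructor
  · have h := (intervalIntegral.intervalIntegrable_rpow' (a := 0) (b := 1)
      (r := 1 - α) (by linarith)).1
    refine h.congr_fun (fun r hr => ?_) measurableSet_Ioc
    have hr0 : 0 < r := hr.1
    simp only [smul_eq_mul]
    rw [min_eq_left (by nlinarith [hr.2]), mul_div_left_comm, hpow hr0, ← Real.rpow_natCast,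
      ← Real.rpow_add hr0]
    congr 1; push_cast; ring
  · have h := integrableOn_Ioi_rpow_of_lt (a := -1 - α) (by linarith) zero_lt_one
    refine h.congr_fun (fun r hr => ?_) measurableSet_Ioi
    have hr1 : 1 < r := hr
    simp only [smul_eq_mul]
    rw [min_eq_right (by nlinarith), mul_div_left_comm, hpow (by linarith), one_mul]

theorem integrable_second_difference_kernel [Nontrivial E] {α : ℝ} (hα1 : 0 < α) (hα2 : α < 2)
    {θ : E → ℝ} (hθ : ContDiff ℝ 2 θ) (hc : HasCompactSupport θ)
    {w : E → ℝ} (hw : Continuous w) {M : ℝ} (hM : ∀ x, |w x| ≤ M) :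
    Integrable (fun p : E × E => w p.1 * ((θ (p.1 + p.2) + θ (p.1 - p.2) - 2 * θ p.1) /
      ‖p.2‖ ^ ((Module.finrank ℝ E : ℝ) + α))) (μ.prod μ) := by
  refine Integrable.bdd_mul (c := M) ?_
    (hw.comp continuous_fst).aestronglyMeasurable (ae_of_all _ fun p => hM p.1)
  have hθc := hθ.continuous
  have hmeas : AEStronglyMeasurable (fun p : E × E =>
      (θ (p.1 + p.2) + θ (p.1 - p.2) - 2 * θ p.1) /
      ‖p.2‖ ^ ((Module.finrank ℝ E : ℝ) + α)) (μ.prod μ) := by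
    have h1 : Measurable fun p : E × E => θ (p.1 + p.2) + θ (p.1 - p.2) - 2 * θ p.1 :=
      Continuous.measurable (by fun_prop)
    exact (h1.div (by fun_prop)).aestronglyMeasurable
  obtain ⟨C, -, hC⟩ := exists_integral_abs_second_difference_le μ hθ hc
  rw [integrable_prod_iff' hmeas]
  refine ⟨ae_of_all _ fun z => (integrable_second_difference μ hθc hc z).div_const
    (‖z‖ ^ ((Module.finrank ℝ E : ℝ) + α)), ?_⟩
  refine ((integrable_min_sq_one_div_rpow μ hα1 hα2).const_mul C).mono'
    hmeas.norm.prod_swap.integral_prod_right' (ae_of_all _ fun z => ?_)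
  have hs : 0 ≤ ‖z‖ ^ ((Module.finrank ℝ E : ℝ) + α) := by positivity
  simp only [norm_div, Real.norm_eq_abs, abs_of_nonneg hs, integral_div]
  rw [abs_of_nonneg (integral_nonneg fun _ => abs_nonneg _), mul_div_assoc']
  exact div_le_div_of_nonneg_right (hC z) hs

end SecondDifference

section MaximumPrinciple

variable {E : Type*} [NormedAddCommGroup E] [InnerProductSpace ℝ E] [FiniteDimensional ℝ E]
  [MeasurableSpace E] [BorelSpace E] (μ : Measure E) [μ.IsAddHaarMeasure]

/-- Mollifying a bounded continuous function that is positive only on a bounded set, one obtains a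
test function supported where the function is positive, at which the correlation of the two
is maximal and positive. -/
theorem exists_test_function_maximizing_correlation
    {w : E → ℝ} (hw : Continuous w) {D : Set E} (hD : Bornology.IsBounded D)
    (hwD : ∀ x ∉ D, w x ≤ 0) {a : E} (ha : 0 < w a) :
    ∃ θ : E → ℝ, ContDiff ℝ (⊤ : ℕ∞) θ ∧ HasCompactSupport θ ∧ (∀ x, 0 ≤ θ x) ∧
      tsupport θ ⊆ {x | 0 < w x} ∧ 0 < ∫ x, w x * θ x ∂μ ∧
      ∀ z, ∫ x, w x * θ (x + z) ∂μ ≤ ∫ x, w x * θ x ∂μ := by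
  set A : Set E := {x | w a / 2 ≤ w x}
  have hAD : A ⊆ D := fun x hx => by
    by_contra h
    have h1 : w a / 2 ≤ w x := hx
    linarith [hwD x h]
  have hA : IsCompact A :=
    Metric.isCompact_of_isClosed_isBounded (isClosed_le continuous_const hw) (hD.subset hAD)
  obtain ⟨δ, hδ, hAδ⟩ := hA.exists_cthickening_subset_open (t := {x | 0 < w x})
    (isOpen_lt continuous_const hw) fun x hx => (half_pos ha).trans_le hx
  obtain ⟨η, hη, hwη⟩ := Metric.continuousAt_iff.1 hw.continuousAt (w a / 4) (by linarith)
  set ε := min (δ / 2) (η / 2)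
  have hε : 0 < ε := by positivity
  let b : ContDiffBump (0 : E) := ⟨ε / 2, ε, by positivity, by linarith⟩
  set φ : E → ℝ := b.normed μ
  have hφ : ContDiff ℝ (⊤ : ℕ∞) φ := b.contDiff_normed
  have hφc : HasCompactSupport φ := b.hasCompactSupport_normed
  have hφ0 (x : E) : 0 ≤ φ x := b.nonneg_normed x
  have hφ1 : ∫ x, φ x ∂μ = 1 := b.integral_normed
  have hφs : tsupport φ = Metric.closedBall 0 ε := b.tsupport_normed_eq
  have hφi : Integrable φ μ := b.integrable_normed
  have hφv {y : E} (hy : y ∉ Metric.closedBall (0 : E) ε) : φ y = 0 := by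
    rw [← hφs] at hy
    exact image_eq_zero_of_notMem_tsupport hy
  have hmi (x : E) : Integrable (fun y => w (x + y) * φ y) μ :=
    ((hw.comp (by fun_prop)).mul hφ.continuous).integrable_of_hasCompactSupport hφc.mul_left
  set W : E → ℝ := fun x => ∫ y, w (x + y) * φ y ∂μ
  have hWc : Continuous W := by
    have h := continuous_parametric_integral_of_continuous (μ := μ)
      (f := fun x y => w (x + y) * φ y) (by have := hφ.continuous; fun_prop)
      (isCompact_closedBall (0 : E) ε)
    refine h.congr fun x => setIntegral_eq_integral_of_forall_compl_eq_zero fun y hy => ?_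
    rw [hφv hy, mul_zero]
  have hW_le {x : E} {c : ℝ} (h : ∀ y, ‖y‖ ≤ ε → w (x + y) ≤ c) : W x ≤ c := by
    calc W x ≤ ∫ y, c * φ y ∂μ := integral_mono (hmi x) (hφi.const_mul c) fun y => by
          by_cases hy : y ∈ Metric.closedBall (0 : E) ε
          · exact mul_le_mul_of_nonneg_right (h y (mem_closedBall_zero_iff.1 hy)) (hφ0 y)
          · simp [hφv hy]
      _ = c := by rw [integral_const_mul, hφ1, mul_one]
  have hWa : w a / 2 < W a := by
    calc w a / 2 < 3 * w a / 4 := by linarith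
      _ = ∫ y, 3 * w a / 4 * φ y ∂μ := by rw [integral_const_mul, hφ1, mul_one]
      _ ≤ W a := integral_mono (hφi.const_mul _) (hmi a) fun y => by
          by_cases hy : y ∈ Metric.closedBall (0 : E) ε
          · refine mul_le_mul_of_nonneg_right ?_ (hφ0 y)
            have hy' : ‖y‖ ≤ η / 2 := (mem_closedBall_zero_iff.1 hy).trans (min_le_right _ _)
            have := hwη (x := a + y) (by rw [dist_eq_norm, add_sub_cancel_left]; linarith)
            rw [Real.dist_eq, abs_lt] at this
            linarith [this.1]
          · simp [hφv hy]
  have hnear {x : E} (hx : w a / 2 < W x) : ∃ y ∈ A, dist y x ≤ ε := by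
    by_contra! h
    refine not_le.2 hx (hW_le fun y hy => ?_)
    by_contra! hlt
    have := h (x + y) hlt.le
    rw [dist_eq_norm, add_sub_cancel_left] at this
    linarith
  obtain ⟨m, hm⟩ := hWc.exists_forall_ge_of_isBounded a <| by
    refine (hA.isBounded.cthickening (δ := ε)).subset fun x hx => ?_
    obtain ⟨y, hyA, hy⟩ := hnear (hWa.trans_le hx)
    exact Metric.mem_cthickening_of_dist_le x y ε A hyA (by rwa [dist_comm])
  have hWφ (z : E) : ∫ x, w x * φ (x - m + z) ∂μ = W (m - z) := by
    rw [← integral_add_right_eq_self _ (m - z)]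
    refine integral_congr_ae (ae_of_all _ fun x => ?_)
    simp only
    congr 2 <;> abel
  have hWm : ∫ x, w x * φ (x - m) ∂μ = W m := by simpa using hWφ 0
  have hts : tsupport (fun x => φ (x - m)) ⊆ Metric.closedBall m ε := by
    refine closure_minimal (fun x hx => ?_) Metric.isClosed_closedBall
    by_contra h
    refine hx (hφv ?_)
    simpa [dist_eq_norm] using h
  refine ⟨fun x => φ (x - m), hφ.comp (by fun_prop), ?_, fun x => hφ0 _, ?_, ?_, fun z => ?_⟩
  · exact HasCompactSupport.of_support_subset_isCompact (isCompact_closedBall m ε)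
      ((subset_tsupport _).trans hts)
  · obtain ⟨y, hyA, hy⟩ := hnear (hWa.trans_le (hm a))
    refine fun x hx => hAδ (Metric.mem_cthickening_of_dist_le x y δ A hyA ?_)
    have h1 : dist x m ≤ ε := hts hx
    have h2 : ε ≤ δ / 2 := min_le_left _ _
    linarith [dist_triangle x m y, dist_comm y m]
  · rw [hWm]
    linarith [hm a]
  · rw [hWm]
    simpa only [add_sub_right_comm, hWφ] using hm (m - z)

theorem nonpos_of_integral_second_difference_nonneg [Nontrivial E] {α : ℝ} (hα1 : 0 < α)
    (hα2 : α < 2) {w : E → ℝ} (hw : Continuous w) {M : ℝ} (hM : ∀ x, |w x| ≤ M)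
    {D : Set E} (hD : Bornology.IsBounded D) (hwD : ∀ x ∉ D, w x ≤ 0)
    (h : ∀ θ : E → ℝ, ContDiff ℝ (⊤ : ℕ∞) θ → HasCompactSupport θ → (∀ x, 0 ≤ θ x) →
      tsupport θ ⊆ {x | 0 < w x} →
      0 ≤ ∫ x, w x * ∫ z, (θ (x + z) + θ (x - z) - 2 * θ x) /
        ‖z‖ ^ ((Module.finrank ℝ E : ℝ) + α) ∂μ ∂μ) (a : E) : w a ≤ 0 := by
  by_contra! ha
  obtain ⟨θ, hθ, hc, hθ0, hθs, hpos, hmax⟩ :=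
    exists_test_function_maximizing_correlation μ hw hD hwD ha
  have hθ2 : ContDiff ℝ 2 θ := hθ.of_le (by exact WithTop.coe_le_coe.2 le_top)
  have hint := integrable_second_difference_kernel μ hα1 hα2 hθ2 hc hw hM
  have hge := h θ hθ hc hθ0 hθs
  simp only [← integral_const_mul] at hge
  rw [integral_integral_swap hint] at hge
  have hint' := hint.integral_prod_right
  simp only [integral_mul_second_difference μ hθ.continuous hc hw] at hge hint'
  have hmax' (z : E) : ∫ x, w x * θ (x - z) ∂μ ≤ ∫ x, w x * θ x ∂μ := by
    simpa [sub_eq_add_neg] using hmax (-z)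
  have hneg (z : E) : ((∫ x, w x * θ (x + z) ∂μ) + (∫ x, w x * θ (x - z) ∂μ) -
      2 * ∫ x, w x * θ x ∂μ) / ‖z‖ ^ ((Module.finrank ℝ E : ℝ) + α) ≤ 0 :=
    div_nonpos_of_nonpos_of_nonneg (by linarith [hmax z, hmax' z]) (by positivity)
  have hzero := (integral_eq_zero_iff_of_nonneg (fun z => neg_nonneg.2 (hneg z)) hint'.neg).1 <|
    le_antisymm (by rw [integral_neg]; linarith) (integral_nonneg fun z => neg_nonneg.2 (hneg z))
  obtain ⟨R, hR⟩ := (hD.union hc.isCompact.isBounded).subset_closedBall 0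
  have hfar {z : E} (hz : 2 * R < ‖z‖) : ∫ x, w x * θ (x + z) ∂μ ≤ 0 := by
    refine integral_nonpos fun x => ?_
    by_cases hx : θ (x + z) = 0
    · simp [hx]
    · refine mul_nonpos_of_nonpos_of_nonneg (hwD x fun hxD => ?_) (hθ0 _)
      have h1 := mem_closedBall_zero_iff.1 (hR (Or.inl hxD))
      have h2 := mem_closedBall_zero_iff.1 (hR (Or.inr (subset_tsupport θ hx)))
      have h3 := norm_sub_le (x + z) x
      rw [add_sub_cancel_left] at h3
      linarith
  have hsub : {z : E | max (2 * R) 0 < ‖z‖} ⊆ {z | ¬ (-(((∫ x, w x * θ (x + z) ∂μ) +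
      (∫ x, w x * θ (x - z) ∂μ) - 2 * ∫ x, w x * θ x ∂μ) /
        ‖z‖ ^ ((Module.finrank ℝ E : ℝ) + α)) = 0)} := by
    intro z hz
    obtain ⟨hz1, hz2⟩ := max_lt_iff.1 (show max (2 * R) 0 < ‖z‖ from hz)
    refine neg_ne_zero.2 (div_neg_of_neg_of_pos ?_ (by positivity)).ne
    linarith [hfar hz1, hmax' z]
  have hnull := measure_mono_null hsub (ae_iff.1 hzero)
  rw [(isOpen_lt continuous_const continuous_norm).measure_eq_zero_iff μ] at hnull
  obtain ⟨z, hz⟩ := NormedSpace.exists_lt_norm ℝ E (max (2 * R) 0)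
  exact (Set.eq_empty_iff_forall_notMem.1 hnull) z hz

end MaximumPrinciple

theorem fracLapCoeff_pos (N : ℕ) {α : ℝ} (hα1 : 0 < α) (hα2 : α < 2) : 0 < fracLapCoeff N α := by
  have h : Real.Gamma (-α / 2) ≠ 0 := by
    refine Real.Gamma_ne_zero fun m hm => ?_
    have h0 : (0 : ℝ) < m := by linarith
    have h1 : (m : ℝ) < 1 := by linarith
    norm_cast at h0 h1
    omega
  have hG : 0 < Real.Gamma (((N : ℝ) + α) / 2) := Real.Gamma_pos_of_pos (by positivity)
  unfold fracLapCoeff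
  positivity

theorem integrable_mul_fracLap {N : ℕ} [Nontrivial (EuclideanSpace ℝ (Fin N))] {α : ℝ}
    (hα1 : 0 < α) (hα2 : α < 2) {θ : EuclideanSpace ℝ (Fin N) → ℝ} (hθ : ContDiff ℝ 2 θ)
    (hc : HasCompactSupport θ) {w : EuclideanSpace ℝ (Fin N) → ℝ} (hw : Continuous w) {M : ℝ}
    (hM : ∀ x, |w x| ≤ M) : Integrable (fun x => w x * fracLap N α θ x) := by
  have h := (integrable_second_difference_kernel volume hα1 hα2 hθ hc hw hM).integral_prod_left
  rw [finrank_euclideanSpace_fin] at h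
  simp only [integral_const_mul] at h
  simpa only [fracLap, mul_left_comm _ (fracLapCoeff N α / 2)] using
    h.const_mul (fracLapCoeff N α / 2)

theorem MeasureTheory.LocallyIntegrableOn.integrableOn_mul_of_hasCompactSupport
    {X : Type*} [TopologicalSpace X] [T2Space X] [MeasurableSpace X] [OpensMeasurableSpace X]
    {μ : Measure X} {g θ : X → ℝ} {D : Set X} (hg : LocallyIntegrableOn g D μ)
    (hθ : Continuous θ) (hc : HasCompactSupport θ) (hD : tsupport θ ⊆ D) :
    IntegrableOn (fun x => g x * θ x) D μ := by
  have h : IntegrableOn (fun x => g x * θ x) (tsupport θ) μ :=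
    (hg.integrableOn_compact_subset hD hc.isCompact).mul_continuousOn hθ.continuousOn hc.isCompact
  refine ((integrableOn_iff_integrable_of_support_subset fun x hx => ?_).1 h).integrableOn
  exact subset_tsupport θ (right_ne_zero_of_mul hx)

/-- the comparison principle.  If `Δ^{α/2}u ≤ ρ·Ψ(u)` and
`Δ^{α/2}v ≥ ρ·Ψ(v)` distributionally on a bounded open set `D` and `u ≥ v`
outside `D`, then `u ≥ v` everywhere. -/
theorem stmt4 (N : ℕ) (hN : 3 ≤ N) (α : ℝ) (hα1 : 0 < α) (hα2 : α < 2)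
    (D : Set (EuclideanSpace ℝ (Fin N))) (hDo : IsOpen D) (hDb : Bornology.IsBounded D)
    (ρ : EuclideanSpace ℝ (Fin N) → ℝ) (hρm : Measurable ρ) (hρnn : ∀ x, 0 ≤ ρ x)
    (hρlb : ∀ R : ℝ, ∃ M : ℝ, ∀ x : EuclideanSpace ℝ (Fin N), ‖x‖ ≤ R → ρ x ≤ M)
    (Ψ : ℝ → ℝ) (hΨmono : Monotone Ψ) (hΨmeas : Measurable Ψ)
    (u v : EuclideanSpace ℝ (Fin N) → ℝ)
    (hu : Continuous u) (hub : ∃ M, ∀ x, |u x| ≤ M)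
    (hv : Continuous v) (hvb : ∃ M, ∀ x, |v x| ≤ M)
    (huint : LocallyIntegrableOn (fun x => ρ x * Ψ (u x)) D)
    (hvint : LocallyIntegrableOn (fun x => ρ x * Ψ (v x)) D)
    (husub : ∀ θ : EuclideanSpace ℝ (Fin N) → ℝ, ContDiff ℝ (⊤ : ℕ∞) θ →
      HasCompactSupport θ → (∀ x, 0 ≤ θ x) → tsupport θ ⊆ D →
      (∫ x, u x * fracLap N α θ x) ≤ ∫ x in D, ρ x * Ψ (u x) * θ x)
    (hvsup : ∀ θ : EuclideanSpace ℝ (Fin N) → ℝ, ContDiff ℝ (⊤ : ℕ∞) θ →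
      HasCompactSupport θ → (∀ x, 0 ≤ θ x) → tsupport θ ⊆ D →
      (∫ x in D, ρ x * Ψ (v x) * θ x) ≤ ∫ x, v x * fracLap N α θ x)
    (hbd : ∀ x ∉ D, v x ≤ u x) :
    ∀ x, v x ≤ u x := by
  have : Nontrivial (EuclideanSpace ℝ (Fin N)) :=
    Module.nontrivial_of_finrank_pos (R := ℝ) (by rw [finrank_euclideanSpace_fin]; omega)
  obtain ⟨Mu, hMu⟩ := hub
  obtain ⟨Mv, hMv⟩ := hvb
  have hcoeff := half_pos (fracLapCoeff_pos N hα1 hα2)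
  suffices h : ∀ x, v x - u x ≤ 0 from fun x => sub_nonpos.1 (h x)
  refine nonpos_of_integral_second_difference_nonneg volume hα1 hα2 (hv.sub hu)
    (M := Mv + Mu) (fun x => (abs_sub _ _).trans (add_le_add (hMv x) (hMu x))) hDb
    (fun x hx => sub_nonpos.2 (hbd x hx)) fun θ hθ hc hθ0 hθs => ?_
  have hGD : {x | 0 < v x - u x} ⊆ D := fun x hx => by
    by_contra hxD
    exact absurd (hbd x hxD) (not_le.2 (sub_pos.1 hx))
  have hθD := hθs.trans hGD
  have hθ2 : ContDiff ℝ 2 θ := hθ.of_le (WithTop.coe_le_coe.2 le_top)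
  have hmono : ∫ x in D, ρ x * Ψ (u x) * θ x ≤ ∫ x in D, ρ x * Ψ (v x) * θ x := by
    refine setIntegral_mono
      (huint.integrableOn_mul_of_hasCompactSupport hθ.continuous hc hθD)
      (hvint.integrableOn_mul_of_hasCompactSupport hθ.continuous hc hθD) fun x => ?_
    by_cases hx : θ x = 0
    · simp [hx]
    · have hlt : u x < v x := sub_pos.1 (hθs (subset_tsupport θ hx))
      exact mul_le_mul_of_nonneg_right
        (mul_le_mul_of_nonneg_left (hΨmono hlt.le) (hρnn x)) (hθ0 x)
  have hle := ((husub θ hθ hc hθ0 hθD).trans hmono).trans (hvsup θ hθ hc hθ0 hθD)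
  have hsub : 0 ≤ ∫ x, (v x - u x) * fracLap N α θ x := by
    simp only [sub_mul]
    rw [integral_sub (integrable_mul_fracLap hα1 hα2 hθ2 hc hv hMv)
      (integrable_mul_fracLap hα1 hα2 hθ2 hc hu hMu)]
    exact sub_nonneg.2 hle
  simp only [fracLap, mul_left_comm _ (fracLapCoeff N α / 2), integral_const_mul] at hsub
  rw [finrank_euclideanSpace_fin]
  exact nonneg_of_mul_nonneg_right hsub hcoeff
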